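/- arXiv:2111.14846 — 2 statements merged into one kernel-verified Lean document; each statement's English description precedes it below -/
import Mathlib

section
/- There exists a universal constant C₀ ≥ 20 such that for every C ≥ C₀ and all sufficiently large N, E_{(X,Y) ~ D}[φ(X,Y)] ≥ ε², where (X,Y) denotes the first N and last N coordinates of a sample from D. -/
open MeasureTheory ProbabilityTheory Finset

noncomputable section

/-- Bit strings of length `n`; there are `N = 2^n` of them. -/
abbrev BV (n : ℕ) := Fin n → Bool

/-- Inner product (mod nothing, just the count) of two bit strings. -/
def bip {n : ℕ} (x y : BV n) : ℕ := (Finset.univ.filter fun i => x i && y i).card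

/-- The `N × N` normalized Walsh-Hadamard matrix, `H_{x,y} = (-1)^{⟨x,y⟩} / √N`. -/
def Had (n : ℕ) : Matrix (BV n) (BV n) ℝ :=
  Matrix.of fun x y => (-1 : ℝ) ^ bip x y / Real.sqrt (2 ^ n)

/-- `ε = 1 / (C ln N)` with `N = 2^n`. -/
def eps (C : ℝ) (n : ℕ) : ℝ := 1 / (C * Real.log (2 ^ n))

/-- The Gaussian vector `X` with i.i.d. `N(0, ε)` coordinates. -/
def gaussVec (C : ℝ) (n : ℕ) : Measure (BV n → ℝ) :=
  Measure.pi fun _ => gaussianReal 0 (eps C n).toNNReal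

/-- The distribution `G'` of `Z = (X, Y∘Y - ε·𝟙)` with `Y = H·X`, packed as a
function on `BV n ⊕ BV n` (first `N` coordinates are `X`, last `N` are `Y∘Y - ε`). -/
def Gmeas' (C : ℝ) (n : ℕ) : Measure (BV n ⊕ BV n → ℝ) :=
  (gaussVec C n).map fun X => Sum.elim X fun i => ((Had n).mulVec X i) ^ 2 - eps C n

/-- Truncation to `[-1, 1]`. -/
def trnc (a : ℝ) : ℝ := min 1 (max (-1) a)

/-- Randomized rounding of `a` to `±1`: output `1` with probability `(1 + trnc a)/2`
and `-1` with probability `(1 - trnc a)/2`. -/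
def roundM (a : ℝ) : Measure ℝ :=
  ((1 + trnc a) / 2).toNNReal • Measure.dirac 1 +
    ((1 - trnc a) / 2).toNNReal • Measure.dirac (-1)

/-- The distribution `D` on `{±1}^{2N}`: sample `z ~ G'` and round each coordinate
independently. -/
def Dmeas (C : ℝ) (n : ℕ) : Measure (BV n ⊕ BV n → ℝ) :=
  (Gmeas' C n).bind fun z => Measure.pi fun i => roundM (z i)

/-- `F : ℝ^ι → ℝ` is multilinear if `F z = Σ_S F̂(S) ∏_{i ∈ S} z_i`. -/
def IsMultilinear {ι : Type*} [Fintype ι] [DecidableEq ι] (F : (ι → ℝ) → ℝ) : Prop :=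
  ∃ c : Finset ι → ℝ, ∀ z, F z = ∑ S : Finset ι, c S * ∏ i ∈ S, z i

/-- The Fourier coefficient `F̂(S)` of `F` (over the hypercube `{±1}^ι`); for a
multilinear `F` these are precisely its multilinear coefficients. -/
def mlCoeff {ι : Type*} [Fintype ι] [DecidableEq ι] (F : (ι → ℝ) → ℝ) (S : Finset ι) : ℝ :=
  (∑ z : ι → Bool, F (fun i => if z i then 1 else -1) * ∏ i ∈ S, (if z i then (1 : ℝ) else -1)) /
    2 ^ Fintype.card ι

/-- `L_{1,2}(F) = Σ_{|S| = 2} |F̂(S)|`. -/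
def L12 {ι : Type*} [Fintype ι] [DecidableEq ι] (F : (ι → ℝ) → ℝ) : ℝ :=
  ∑ S ∈ Finset.univ.filter (fun S : Finset ι => S.card = 2), |mlCoeff F S|

/-- The restriction `F_ρ` of `F` under `ρ = (S, w)`: coordinates outside `S` are
fixed to the values of `w`. -/
def restrictML {ι : Type*} [DecidableEq ι] (F : (ι → ℝ) → ℝ) (S : Finset ι)
    (w : ι → ℝ) : (ι → ℝ) → ℝ :=
  fun y => F fun i => if i ∈ S then y i else w i

/-- `φ(X, Y) = (1/N) Σ_i (Σ_j H_{ij} X_j)² Y_i`. -/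
def phi (n : ℕ) (X Y : BV n → ℝ) : ℝ :=
  (∑ i, ((Had n).mulVec X i) ^ 2 * Y i) / 2 ^ n

/-- The multilinear part `φ_{i≠j}(X, Y) = (1/N) Σ_i Σ_{j ≠ k} H_{ij} H_{ik} X_j X_k Y_i`. -/
def phiOff (n : ℕ) (X Y : BV n → ℝ) : ℝ :=
  (∑ i, ∑ j, ∑ k ∈ Finset.univ \ {j}, Had n i j * Had n i k * X j * X k * Y i) / 2 ^ n

/-- The Fourier coefficient `f̂(x) = 2^{-n} Σ_y f(y) (-1)^{⟨x,y⟩}` of `f : {0,1}^n → {±1}`. -/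
def hatF (n : ℕ) (f : BV n → ℝ) (x : BV n) : ℝ :=
  (∑ y, f y * (-1 : ℝ) ^ bip x y) / 2 ^ n

theorem Had_mul_Had (n : ℕ) (i j k : BV n) :
    Had n i j * Had n i k = (∏ t, ((if i t && j t then (-1 : ℝ) else 1) *
      (if i t && k t then (-1 : ℝ) else 1))) / 2 ^ n := by
  have h : ∀ x y : BV n, (-1 : ℝ) ^ bip x y = ∏ t, (if x t && y t then (-1 : ℝ) else 1) := by
    intro x y
    rw [Finset.prod_ite, Finset.prod_const, Finset.prod_const_one, mul_one]
    rfl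
  have h2 : Real.sqrt (2 ^ n) * Real.sqrt (2 ^ n) = 2 ^ n := Real.mul_self_sqrt (by positivity)
  simp only [Had, Matrix.of_apply]
  rw [div_mul_div_comm, h2, h, h, Finset.prod_mul_distrib]

theorem Had_sq (n : ℕ) (i j : BV n) : Had n i j ^ 2 = 1 / 2 ^ n := by
  rw [sq, Had_mul_Had]
  congr 1
  exact Finset.prod_eq_one fun t _ => by split_ifs <;> norm_num

theorem sum_Had_mul_Had (n : ℕ) (j k : BV n) :
    ∑ i, Had n i j * Had n i k = if j = k then 1 else 0 := by
  simp only [Had_mul_Had, ← Finset.sum_div]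
  have h := Finset.prod_univ_sum (fun _ : Fin n => (Finset.univ : Finset Bool))
    (fun t b => (if b && j t then (-1 : ℝ) else 1) * (if b && k t then (-1 : ℝ) else 1))
  rw [Fintype.piFinset_univ] at h
  rw [← h]
  split_ifs with hjk
  · subst hjk
    have : ∀ t, (∑ b : Bool, (if b && j t then (-1 : ℝ) else 1) *
        (if b && j t then (-1 : ℝ) else 1)) = 2 := by
      intro t
      cases j t <;> norm_num
    rw [Finset.prod_congr rfl fun t _ => this t]
    simp
  · obtain ⟨t, ht⟩ := Function.ne_iff.mp hjk
    rw [Finset.prod_eq_zero (Finset.mem_univ t), zero_div]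
    revert ht
    cases j t <;> cases k t <;> norm_num

theorem sum_mulVec_Had_sq (n : ℕ) (x : BV n → ℝ) :
    ∑ i, ((Had n).mulVec x i) ^ 2 = ∑ j, x j ^ 2 := by
  have h : ∀ i, ((Had n).mulVec x i) ^ 2 =
      ∑ j, ∑ k, (Had n i j * Had n i k) * (x j * x k) := by
    intro i
    simp only [Matrix.mulVec, dotProduct, sq, Finset.sum_mul_sum]
    exact Finset.sum_congr rfl fun j _ => Finset.sum_congr rfl fun k _ => by ring
  simp only [h]
  rw [Finset.sum_comm]
  refine Finset.sum_congr rfl fun j _ => ?_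
  rw [Finset.sum_comm]
  simp only [← Finset.sum_mul, sum_Had_mul_Had]
  simp [sq]

theorem abs_trnc_le (a : ℝ) : |trnc a| ≤ 1 := by
  unfold trnc
  rw [abs_le]
  exact ⟨le_min (by norm_num) (le_max_left _ _), min_le_left _ _⟩

theorem trnc_eq_self {a : ℝ} (ha : |a| ≤ 1) : trnc a = a := by
  obtain ⟨h1, h2⟩ := abs_le.mp ha
  rw [trnc, max_eq_right h1, min_eq_right h2]

theorem measurable_trnc : Measurable trnc := by
  unfold trnc
  fun_prop

theorem roundM_weights (a : ℝ) : 0 ≤ (1 + trnc a) / 2 ∧ 0 ≤ (1 - trnc a) / 2 := by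
  obtain ⟨h1, h2⟩ := abs_le.mp (abs_trnc_le a)
  constructor <;> linarith

instance (a : ℝ) : IsProbabilityMeasure (roundM a) := by
  constructor
  obtain ⟨h1, h2⟩ := roundM_weights a
  simp only [roundM, Measure.add_apply, Measure.smul_apply, measure_univ]
  rw [ENNReal.smul_def, ENNReal.smul_def, smul_eq_mul, smul_eq_mul, mul_one, mul_one,
    ← ENNReal.coe_add, ← Real.toNNReal_add h1 h2]
  norm_num
  ring_nf

theorem integral_roundM (a : ℝ) : ∫ x, x ∂(roundM a) = trnc a := by
  obtain ⟨h1, h2⟩ := roundM_weights a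
  rw [roundM, integral_add_measure, integral_smul_nnreal_measure, integral_smul_nnreal_measure]
  · simp only [integral_dirac, NNReal.smul_def, Real.coe_toNNReal _ h1, Real.coe_toNNReal _ h2,
      smul_eq_mul]
    ring
  · exact (integrable_dirac (by simp)).smul_measure_nnreal
  · exact (integrable_dirac (by simp)).smul_measure_nnreal

theorem ae_roundM (a : ℝ) : ∀ᵐ x ∂(roundM a), x = 1 ∨ x = -1 := by
  rw [roundM, ae_add_measure_iff]
  constructor
  · refine Measure.ae_smul_measure ?_ _
    simp [ae_dirac_eq]
  · refine Measure.ae_smul_measure ?_ _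
    simp [ae_dirac_eq]

theorem measurable_roundM : Measurable roundM := by
  refine Measure.measurable_of_measurable_coe _ fun s hs => ?_
  simp only [roundM, Measure.add_apply, Measure.smul_apply, ENNReal.smul_def, smul_eq_mul]
  have := measurable_trnc
  fun_prop

theorem measurable_pi_roundM {ι : Type*} [Fintype ι] :
    Measurable fun z : ι → ℝ => Measure.pi fun i => roundM (z i) := by
  refine Measurable.measure_of_isPiSystem_of_isProbabilityMeasure generateFrom_pi.symm
    isPiSystem_pi ?_
  rintro _ ⟨s, hs, rfl⟩
  simp only [Measure.pi_pi]
  refine Finset.measurable_fun_prod _ fun i _ => ?_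
  have hsi : MeasurableSet (s i) := hs i (Set.mem_univ i)
  exact (Measure.measurable_coe hsi).comp
    (measurable_roundM.comp (measurable_pi_apply i))

theorem ae_pi_roundM {ι : Type*} [Fintype ι] (z : ι → ℝ) :
    ∀ᵐ y ∂(Measure.pi fun i => roundM (z i)), ∀ i, y i = 1 ∨ y i = -1 := by
  rw [ae_all_iff]
  intro i
  exact (Measure.quasiMeasurePreserving_eval (fun i => roundM (z i)) i).ae (ae_roundM (z i))

theorem integrable_pi_roundM {ι : Type*} [Fintype ι] (z : ι → ℝ)
    {f : (ι → ℝ) → ℝ} (hf : Continuous f) :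
    Integrable f (Measure.pi fun i => roundM (z i)) := by
  have hc : IsCompact (Set.Icc (-1 : ι → ℝ) 1) := isCompact_Icc
  obtain ⟨c, hc⟩ := hc.exists_bound_of_continuousOn hf.continuousOn
  refine Integrable.of_bound hf.aestronglyMeasurable c ?_
  filter_upwards [ae_pi_roundM z] with y hy
  refine hc y ⟨fun i => ?_, fun i => ?_⟩ <;> rcases hy i with h | h <;> simp [h]

theorem integral_pi_roundM_eval {ι : Type*} [Fintype ι] (z : ι → ℝ) (i : ι) :
    ∫ y, y i ∂(Measure.pi fun i => roundM (z i)) = trnc (z i) := by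
  rw [← integral_roundM, ← (measurePreserving_eval (fun i => roundM (z i)) i).map_eq,
    integral_map (measurable_pi_apply i).aemeasurable (by fun_prop)]

theorem integral_pi_roundM_mul {ι : Type*} [Fintype ι] (z : ι → ℝ) {j k l : ι}
    (hjk : j ≠ k) (hjl : j ≠ l) (hkl : k ≠ l) :
    ∫ y, y j * y k * y l ∂(Measure.pi fun i => roundM (z i)) =
      trnc (z j) * trnc (z k) * trnc (z l) := by
  have hi : iIndepFun (fun i (y : ι → ℝ) => y i) (Measure.pi fun i => roundM (z i)) :=
    iIndepFun_pi (X := fun i (x : ℝ) => x) (fun i => aemeasurable_id)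
  have h1 := hi.indepFun_mul_left (fun i => measurable_pi_apply i) j k l hjl hkl
  have h2 := hi.indepFun hjk
  have e1 := h1.integral_fun_mul_eq_mul_integral (Continuous.aestronglyMeasurable (by fun_prop))
    (Continuous.aestronglyMeasurable (by fun_prop))
  have e2 := h2.integral_fun_mul_eq_mul_integral (Continuous.aestronglyMeasurable (by fun_prop))
    (Continuous.aestronglyMeasurable (by fun_prop))
  simp only [Pi.mul_apply] at e1
  rw [e1, e2, integral_pi_roundM_eval, integral_pi_roundM_eval, integral_pi_roundM_eval]

theorem integral_pi_roundM_sq_mul {ι : Type*} [Fintype ι] (z : ι → ℝ) (j l : ι) :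
    ∫ y, y j * y j * y l ∂(Measure.pi fun i => roundM (z i)) = trnc (z l) := by
  rw [← integral_pi_roundM_eval]
  refine integral_congr_ae ?_
  filter_upwards [ae_pi_roundM z] with y hy
  rcases hy j with h | h <;> simp [h]

theorem phi_eq_sum (n : ℕ) (X Y : BV n → ℝ) :
    phi n X Y = (∑ i, ∑ j, ∑ k, Had n i j * Had n i k * (X j * X k * Y i)) / 2 ^ n := by
  unfold phi
  congr 1
  refine Finset.sum_congr rfl fun i _ => ?_
  rw [Matrix.mulVec, dotProduct, sq, Finset.sum_mul_sum, Finset.sum_mul]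
  refine Finset.sum_congr rfl fun j _ => ?_
  rw [Finset.sum_mul]
  exact Finset.sum_congr rfl fun k _ => by ring

/-- The conditional expectation of `phi` under independent rounding of the point `(x, y)`. -/
def roundedPhi (n : ℕ) (x y : BV n → ℝ) : ℝ :=
  (∑ i, (((Had n).mulVec (fun j => trnc (x j)) i) ^ 2 + 1 - (∑ j, trnc (x j) ^ 2) / 2 ^ n) *
    trnc (y i)) / 2 ^ n

theorem roundedPhi_eq_sum (n : ℕ) (x y : BV n → ℝ) :
    roundedPhi n x y = (∑ i, ∑ j, ∑ k, Had n i j * Had n i k *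
      (if j = k then trnc (y i) else trnc (x j) * trnc (x k) * trnc (y i))) / 2 ^ n := by
  have h := phi_eq_sum n (fun j => trnc (x j)) (fun i => trnc (y i))
  have e : ∀ i j k : BV n, Had n i j * Had n i k *
      (if j = k then trnc (y i) else trnc (x j) * trnc (x k) * trnc (y i)) =
      Had n i j * Had n i k * (trnc (x j) * trnc (x k) * trnc (y i)) +
      if j = k then 1 / 2 ^ n * ((1 - trnc (x j) ^ 2) * trnc (y i)) else 0 := by
    intro i j k
    split_ifs with hjk
    · subst hjk
      rw [← Had_sq n i j]
      ring
    · ring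
  simp only [e, Finset.sum_add_distrib, add_div]
  rw [← h, roundedPhi, phi, ← add_div, ← Finset.sum_add_distrib]
  congr 1
  refine Finset.sum_congr rfl fun i _ => ?_
  simp only [Finset.sum_ite_eq, Finset.mem_univ, if_true, ← Finset.mul_sum, ← Finset.sum_mul,
    Finset.sum_sub_distrib]
  simp
  field_simp
  ring

theorem abs_roundedPhi_le (n : ℕ) (x y : BV n → ℝ) : |roundedPhi n x y| ≤ 2 ^ n := by
  rw [roundedPhi_eq_sum, abs_div, abs_of_pos (by positivity : (0 : ℝ) < 2 ^ n),
    div_le_iff₀ (by positivity)]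
  have hterm : ∀ i j k : BV n, |Had n i j * Had n i k *
      (if j = k then trnc (y i) else trnc (x j) * trnc (x k) * trnc (y i))| ≤ 1 / 2 ^ n := by
    intro i j k
    have hH : |Had n i j * Had n i k| = 1 / 2 ^ n := by
      rw [← sq_eq_sq₀ (abs_nonneg _) (by positivity), sq_abs, mul_pow, Had_sq, Had_sq, sq]
    rw [abs_mul, hH]
    refine mul_le_of_le_one_right (by positivity) ?_
    split_ifs
    · exact abs_trnc_le _
    · rw [abs_mul, abs_mul]
      exact mul_le_one₀ (mul_le_one₀ (abs_trnc_le _) (abs_nonneg _) (abs_trnc_le _))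
        (abs_nonneg _) (abs_trnc_le _)
  calc _ ≤ ∑ i : BV n, ∑ j : BV n, ∑ k : BV n, (1 : ℝ) / 2 ^ n := by
        refine (Finset.abs_sum_le_sum_abs _ _).trans (Finset.sum_le_sum fun i _ => ?_)
        refine (Finset.abs_sum_le_sum_abs _ _).trans (Finset.sum_le_sum fun j _ => ?_)
        exact (Finset.abs_sum_le_sum_abs _ _).trans (Finset.sum_le_sum fun k _ => hterm i j k)
    _ = 2 ^ n * 2 ^ n := by simp

theorem continuous_phi (n : ℕ) : Continuous fun z : BV n ⊕ BV n → ℝ =>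
    phi n (fun i => z (Sum.inl i)) (fun i => z (Sum.inr i)) := by
  simp only [phi_eq_sum]
  fun_prop

theorem integral_phi_pi_roundM (n : ℕ) (z : BV n ⊕ BV n → ℝ) :
    ∫ w, phi n (fun i => w (Sum.inl i)) (fun i => w (Sum.inr i))
      ∂(Measure.pi fun i => roundM (z i)) =
    roundedPhi n (fun i => z (Sum.inl i)) (fun i => z (Sum.inr i)) := by
  simp only [phi_eq_sum, roundedPhi_eq_sum]
  rw [integral_div, integral_finsetSum _ fun i _ => integrable_pi_roundM z (by fun_prop)]
  congr 1
  refine Finset.sum_congr rfl fun i _ => ?_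
  rw [integral_finsetSum _ fun j _ => integrable_pi_roundM z (by fun_prop)]
  refine Finset.sum_congr rfl fun j _ => ?_
  rw [integral_finsetSum _ fun k _ => integrable_pi_roundM z (by fun_prop)]
  refine Finset.sum_congr rfl fun k _ => ?_
  rw [integral_const_mul]
  congr 1
  split_ifs with hjk
  · subst hjk
    exact integral_pi_roundM_sq_mul z _ _
  · exact integral_pi_roundM_mul z (by simpa using hjk) (by simp) (by simp)

instance (C : ℝ) (n : ℕ) : IsProbabilityMeasure (gaussVec C n) := by
  unfold gaussVec
  infer_instance

theorem measurable_Gmeas'_map (C : ℝ) (n : ℕ) : Measurable fun X : BV n → ℝ =>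
    (Sum.elim X fun i => ((Had n).mulVec X i) ^ 2 - eps C n : BV n ⊕ BV n → ℝ) := by
  refine measurable_pi_lambda _ fun i => ?_
  cases i with
  | inl i => exact measurable_pi_apply i
  | inr i =>
    simp only [Sum.elim_inr, Matrix.mulVec, dotProduct]
    fun_prop

theorem measurable_roundedPhi (n : ℕ) : Measurable fun z : BV n ⊕ BV n → ℝ =>
    roundedPhi n (fun i => z (Sum.inl i)) (fun i => z (Sum.inr i)) := by
  have := measurable_trnc
  simp only [roundedPhi, Matrix.mulVec, dotProduct]
  fun_prop

theorem integral_phi_Dmeas (C : ℝ) (n : ℕ) :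
    ∫ z, phi n (fun i => z (Sum.inl i)) (fun i => z (Sum.inr i)) ∂(Dmeas C n) =
      ∫ X, roundedPhi n X (fun i => ((Had n).mulVec X i) ^ 2 - eps C n) ∂(gaussVec C n) := by
  let κ : Kernel (BV n ⊕ BV n → ℝ) (BV n ⊕ BV n → ℝ) :=
    ⟨fun z => Measure.pi fun i => roundM (z i), measurable_pi_roundM⟩
  have : IsMarkovKernel κ :=
    ⟨fun z => by change IsProbabilityMeasure (Measure.pi _); infer_instance⟩
  have : IsProbabilityMeasure (Gmeas' C n) :=
    Measure.isProbabilityMeasure_map (measurable_Gmeas'_map C n).aemeasurable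
  have hD : Dmeas C n = (Kernel.comp κ (Kernel.const Unit (Gmeas' C n))) () := by
    rw [← Measure.comp_eq_comp_const_apply]
    rfl
  have hae : ∀ᵐ w ∂(Dmeas C n), ∀ i, w i = 1 ∨ w i = -1 := by
    refine Measure.ae_comp_of_ae_ae (κ := κ) ?_ (Filter.Eventually.of_forall ae_pi_roundM)
    simp only [Set.ofPred_forall, Set.ofPred_or]
    refine MeasurableSet.iInter fun i => ?_
    exact (measurableSet_eq_fun (measurable_pi_apply i) measurable_const).union
      (measurableSet_eq_fun (measurable_pi_apply i) measurable_const)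
  have hint : Integrable (fun z : BV n ⊕ BV n → ℝ =>
      phi n (fun i => z (Sum.inl i)) (fun i => z (Sum.inr i))) (Dmeas C n) := by
    have hcpt : IsCompact (Set.Icc (-1 : BV n ⊕ BV n → ℝ) 1) := isCompact_Icc
    obtain ⟨c, hc⟩ := hcpt.exists_bound_of_continuousOn (continuous_phi n).continuousOn
    have : IsProbabilityMeasure (Dmeas C n) := by rw [hD]; infer_instance
    refine Integrable.of_bound (continuous_phi n).aestronglyMeasurable c ?_
    filter_upwards [hae] with y hy
    refine hc y ⟨fun i => ?_, fun i => ?_⟩ <;> rcases hy i with h | h <;> simp [h]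
  rw [hD] at hint ⊢
  rw [Kernel.integral_comp hint, Kernel.const_apply]
  have : ∀ z, ∫ w, phi n (fun i => w (Sum.inl i)) (fun i => w (Sum.inr i)) ∂(κ z) =
      roundedPhi n (fun i => z (Sum.inl i)) (fun i => z (Sum.inr i)) :=
    integral_phi_pi_roundM n
  simp only [this]
  rw [Gmeas', integral_map (measurable_Gmeas'_map C n).aemeasurable
    (measurable_roundedPhi n).aestronglyMeasurable]
  rfl

open scoped NNReal Nat in
theorem integral_pow_two_mul_gaussianReal {v : ℝ≥0} (hv : v ≠ 0) (m : ℕ) :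
    ∫ x, x ^ (2 * m) ∂(gaussianReal 0 v) = v ^ m * (2 * m - 1 : ℕ)‼ := by
  have hv0 : (0 : ℝ) < v := by positivity
  rw [integral_gaussianReal_eq_integral_smul hv]
  have h1 : ∀ x : ℝ, gaussianPDFReal 0 v x • x ^ (2 * m) = (fun y : ℝ =>
      (√(2 * Real.pi * v))⁻¹ * (y ^ (2 * m) * Real.exp (-(1 / (2 * v)) * y ^ 2))) |x| := by
    intro x
    simp only [gaussianPDFReal, smul_eq_mul, sub_zero, sq_abs, (even_two_mul m).pow_abs]
    rw [show -(1 / (2 * (v : ℝ))) * x ^ 2 = -x ^ 2 / (2 * v) by ring]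
    ring
  rw [integral_congr_ae (Filter.Eventually.of_forall h1), integral_comp_abs (f := fun y : ℝ =>
    (√(2 * Real.pi * v))⁻¹ * (y ^ (2 * m) * Real.exp (-(1 / (2 * v)) * y ^ 2))),
    integral_const_mul]
  have h2 := integral_rpow_mul_exp_neg_mul_rpow (p := 2) (q := (2 * m : ℕ)) (b := 1 / (2 * v))
    (by norm_num) (neg_one_lt_zero.trans_le (Nat.cast_nonneg _)) (by positivity)
  simp only [Real.rpow_natCast, Real.rpow_two] at h2
  rw [h2]
  have e1 : (((2 * m : ℕ) : ℝ) + 1) / 2 = m + 1 / 2 := by push_cast; ring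
  have e2 : -(((2 * m : ℕ) : ℝ) + 1) / 2 = -(m + 1 / 2) := by push_cast; ring
  rw [e1, e2, Real.Gamma_nat_add_half, one_div, Real.inv_rpow (by positivity),
    Real.rpow_neg (by positivity), inv_inv, Real.rpow_add (by positivity), Real.rpow_natCast,
    ← Real.sqrt_eq_rpow, show 2 * Real.pi * (v : ℝ) = Real.pi * (2 * v) by ring,
    Real.sqrt_mul Real.pi_pos.le]
  have : √Real.pi ≠ 0 := by positivity
  have : √(2 * (v : ℝ)) ≠ 0 := by positivity
  field_simp
  ring

open scoped NNReal in
theorem integrable_pow_gaussianReal (v : ℝ≥0) (m : ℕ) :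
    Integrable (fun x => x ^ m) (gaussianReal 0 v) := by
  have h := (memLp_id_gaussianReal (μ := 0) (v := v) m).integrable_norm_pow'
  refine h.mono (by fun_prop) (Filter.Eventually.of_forall fun x => ?_)
  simp

open scoped NNReal in
theorem hasSubgaussianMGF_gaussianReal (v : ℝ≥0) :
    HasSubgaussianMGF (fun x => x) v (gaussianReal 0 v) where
  integrable_exp_mul := integrable_exp_mul_gaussianReal
  mgf_le t := by
    rw [mgf_fun_id_gaussianReal]
    simp

open scoped NNReal in
theorem gaussianReal_one_lt_abs_le (v : ℝ≥0) :
    (gaussianReal 0 v).real {x | 1 < |x|} ≤ 2 * Real.exp (-1 / (2 * v)) := by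
  have h1 := (hasSubgaussianMGF_gaussianReal v).measure_ge_le zero_le_one
  have h2 := (hasSubgaussianMGF_gaussianReal v).neg.measure_ge_le zero_le_one
  have hs : {x : ℝ | 1 < |x|} ⊆ {x | 1 ≤ x} ∪ {x | 1 ≤ (-fun x : ℝ => x) x} := by
    intro x hx
    rcases lt_abs.mp (show 1 < |x| from hx) with h | h
    · exact Or.inl h.le
    · exact Or.inr h.le
  have h3 := (measureReal_mono hs (μ := gaussianReal 0 v)).trans (measureReal_union_le _ _)
  rw [one_pow] at h1 h2
  linarith

open scoped NNReal in
theorem map_sum_mul_pi_gaussianReal {ι : Type*} [Fintype ι] (v : ℝ≥0) (a : ι → ℝ)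
    (ha : ∑ j, a j ^ 2 = 1) :
    (Measure.pi fun _ : ι => gaussianReal 0 v).map (fun x => ∑ j, a j * x j) =
      gaussianReal 0 v := by
  have hind : iIndepFun (fun j (x : ι → ℝ) => a j * x j)
      (Measure.pi fun _ : ι => gaussianReal 0 v) :=
    iIndepFun_pi (X := fun j (x : ℝ) => a j * x) (fun j => by fun_prop)
  have hlaw : ∀ j, HasLaw (fun x : ι → ℝ => x j) (gaussianReal 0 v)
      (Measure.pi fun _ : ι => gaussianReal 0 v) := fun j =>
    (measurePreserving_eval (fun _ : ι => gaussianReal 0 v) j).hasLaw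
  have hg : HasGaussianLaw (fun x : ι → ℝ => ∑ j, a j * x j)
      (Measure.pi fun _ : ι => gaussianReal 0 v) :=
    hind.hasGaussianLaw_fun_sum fun j => (gaussianReal_const_mul (hlaw j) (a j)).hasGaussianLaw
  rw [hg.map_eq_gaussianReal]
  have hmem : ∀ j, MemLp (fun x : ℝ => a j * x) 2 (gaussianReal 0 v) := fun j =>
    (memLp_id_gaussianReal 2).const_mul (a j)
  have hvar := variance_sum_pi (X := fun j (x : ℝ) => a j * x) hmem
  have hfun : (∑ j, fun x : ι → ℝ => a j * x j) = fun x => ∑ j, a j * x j := by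
    ext x
    simp
  rw [hfun] at hvar
  congr 1
  · rw [integral_finsetSum]
    · refine Finset.sum_eq_zero fun j _ => ?_
      rw [integral_const_mul, (hlaw j).integral_eq]
      simp
    · intro j _
      have := (hlaw j).map_eq ▸ integrable_pow_gaussianReal v 1
      have := this.comp_measurable (measurable_pi_apply j)
      simpa using Integrable.const_mul this (a j)
  · have hv : ∀ j, variance (fun x : ℝ => a j * x) (gaussianReal 0 v) = a j ^ 2 * v := fun j => by
      rw [variance_const_mul, variance_fun_id_gaussianReal]
    rw [hvar, Finset.sum_congr rfl fun j _ => hv j, ← Finset.sum_mul, ha]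
    simp

theorem roundedPhi_of_abs_le_one (n : ℕ) (e : ℝ) (x : BV n → ℝ) (hx : ∀ j, |x j| ≤ 1)
    (he0 : 0 ≤ e) (he1 : e ≤ 1) (hy : ∀ i, |(Had n).mulVec x i| ≤ 1) :
    roundedPhi n x (fun i => ((Had n).mulVec x i) ^ 2 - e) =
      (∑ i, ((Had n).mulVec x i) ^ 4) / 2 ^ n + (∑ j, x j ^ 2) / 2 ^ n
        - ((∑ j, x j ^ 2) / 2 ^ n) ^ 2 - e := by
  have h1 : ∀ j, trnc (x j) = x j := fun j => trnc_eq_self (hx j)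
  have h2 : ∀ i, trnc (((Had n).mulVec x i) ^ 2 - e) = ((Had n).mulVec x i) ^ 2 - e := by
    intro i
    have h3 := (sq_le_one_iff_abs_le_one _).mpr (hy i)
    have h4 := sq_nonneg ((Had n).mulVec x i)
    exact trnc_eq_self (abs_le.mpr ⟨by linarith, by linarith⟩)
  simp only [roundedPhi, h1, h2]
  have h5 : ∀ i, (((Had n).mulVec x i) ^ 2 + 1 - (∑ j, x j ^ 2) / 2 ^ n) *
      (((Had n).mulVec x i) ^ 2 - e) = ((Had n).mulVec x i) ^ 4 +
      ((1 - (∑ j, x j ^ 2) / 2 ^ n) - e) * ((Had n).mulVec x i) ^ 2 -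
      e * (1 - (∑ j, x j ^ 2) / 2 ^ n) := fun i => by ring
  simp only [h5, Finset.sum_add_distrib, Finset.sum_sub_distrib, ← Finset.mul_sum,
    sum_mulVec_Had_sq]
  simp
  field_simp
  ring

theorem le_roundedPhi (n : ℕ) (e : ℝ) (he0 : 0 ≤ e) (he1 : e ≤ 1) (x : BV n → ℝ)
    (B : Set (BV n → ℝ)) (hB : x ∉ B → (∀ j, |x j| ≤ 1) ∧ ∀ i, |(Had n).mulVec x i| ≤ 1) :
    (∑ i, ((Had n).mulVec x i) ^ 4) / 2 ^ n + (∑ j, x j ^ 2) / 2 ^ n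
        - ((∑ j, x j ^ 2) / 2 ^ n) ^ 2 - e
        - (∑ i, (((Had n).mulVec x i) ^ 8 + ((Had n).mulVec x i) ^ 4)) / 2 ^ n / 1000
        - B.indicator (fun _ => 2 ^ n + 500) x ≤
      roundedPhi n x (fun i => ((Had n).mulVec x i) ^ 2 - e) := by
  by_cases hx : x ∈ B
  · rw [Set.indicator_of_mem hx]
    have h1 := (abs_le.mp (abs_roundedPhi_le n x (fun i => ((Had n).mulVec x i) ^ 2 - e))).1
    have h2 : (∑ i, ((Had n).mulVec x i) ^ 4) / 2 ^ n + (∑ j, x j ^ 2) / 2 ^ n ≤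
        (∑ i, (((Had n).mulVec x i) ^ 8 + ((Had n).mulVec x i) ^ 4)) / 2 ^ n / 1000 + 500 := by
      rw [← sum_mulVec_Had_sq, ← add_div, ← Finset.sum_add_distrib]
      have h3 : ∑ i, (((Had n).mulVec x i) ^ 4 + ((Had n).mulVec x i) ^ 2) ≤
          ∑ i, ((((Had n).mulVec x i) ^ 8 + ((Had n).mulVec x i) ^ 4) / 1000 + 500) :=
        Finset.sum_le_sum fun i _ => by
          nlinarith [sq_nonneg (((Had n).mulVec x i) ^ 4 - 500),
            sq_nonneg (((Had n).mulVec x i) ^ 2 - 500)]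
      rw [div_le_iff₀ (by positivity)]
      refine h3.trans (le_of_eq ?_)
      rw [Finset.sum_add_distrib, ← Finset.sum_div]
      simp
      field_simp
    have h4 := sq_nonneg ((∑ j, x j ^ 2) / 2 ^ n)
    linarith
  · rw [Set.indicator_of_notMem hx, roundedPhi_of_abs_le_one n e x (hB hx).1 he0 he1 (hB hx).2]
    have : 0 ≤ (∑ i, (((Had n).mulVec x i) ^ 8 + ((Had n).mulVec x i) ^ 4)) / 2 ^ n / 1000 := by
      positivity
    linarith

theorem measurable_mulVec_Had (n : ℕ) (i : BV n) :
    Measurable fun x : BV n → ℝ => (Had n).mulVec x i := by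
  simp only [Matrix.mulVec, dotProduct]
  fun_prop

theorem measurePreserving_eval_gaussVec (C : ℝ) (n : ℕ) (j : BV n) :
    MeasurePreserving (fun x : BV n → ℝ => x j) (gaussVec C n)
      (gaussianReal 0 (eps C n).toNNReal) :=
  measurePreserving_eval (fun _ : BV n => gaussianReal 0 (eps C n).toNNReal) j

theorem measurePreserving_mulVec_gaussVec (C : ℝ) (n : ℕ) (i : BV n) :
    MeasurePreserving (fun x : BV n → ℝ => (Had n).mulVec x i) (gaussVec C n)
      (gaussianReal 0 (eps C n).toNNReal) :=
  ⟨measurable_mulVec_Had n i, map_sum_mul_pi_gaussianReal _ (fun j => Had n i j)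
    (by simp [Had_sq])⟩

section GaussianMoments

variable {Ω : Type*} [MeasurableSpace Ω] {μ : Measure Ω} {v : NNReal} {f : Ω → ℝ}

theorem integrable_pow_of_gaussian (hf : MeasurePreserving f μ (gaussianReal 0 v)) (m : ℕ) :
    Integrable (fun x => f x ^ m) μ :=
  hf.integrable_comp_of_integrable (integrable_pow_gaussianReal v m)

open scoped Nat in
theorem integral_pow_of_gaussian (hf : MeasurePreserving f μ (gaussianReal 0 v)) (hv : v ≠ 0)
    (m : ℕ) : ∫ x, f x ^ (2 * m) ∂μ = v ^ m * (2 * m - 1 : ℕ)‼ := by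
  rw [← integral_pow_two_mul_gaussianReal hv, ← hf.map_eq,
    integral_map hf.measurable.aemeasurable (by fun_prop)]

theorem measureReal_one_lt_abs_le_of_gaussian (hf : MeasurePreserving f μ (gaussianReal 0 v)) :
    μ.real {x | 1 < |f x|} ≤ 2 * Real.exp (-1 / (2 * v)) := by
  refine le_trans (le_of_eq ?_) (gaussianReal_one_lt_abs_le v)
  exact hf.measureReal_preimage
    (measurableSet_lt measurable_const measurable_abs).nullMeasurableSet

end GaussianMoments

theorem integral_sq_sum_sq_gaussVec (C : ℝ) (n : ℕ) (he : 0 < eps C n) :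
    Integrable (fun x : BV n → ℝ => (∑ j, x j ^ 2) ^ 2) (gaussVec C n) ∧
    ∫ x : BV n → ℝ, (∑ j, x j ^ 2) ^ 2 ∂(gaussVec C n) =
      2 * 2 ^ n * eps C n ^ 2 + (2 ^ n * eps C n) ^ 2 := by
  have hv : (eps C n).toNNReal ≠ 0 := by simpa using he
  have hvc : ((eps C n).toNNReal : ℝ) = eps C n := Real.coe_toNNReal _ he.le
  have hmem : MemLp (fun x : ℝ => x ^ 2) 2 (gaussianReal 0 (eps C n).toNNReal) := by
    rw [memLp_two_iff_integrable_sq (by fun_prop)]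
    simpa only [← pow_mul] using integrable_pow_gaussianReal _ 4
  have hvar1 : variance (fun x : ℝ => x ^ 2) (gaussianReal 0 (eps C n).toNNReal) =
      2 * eps C n ^ 2 := by
    rw [variance_eq_sub hmem]
    have h2 := integral_pow_two_mul_gaussianReal hv 1
    have h4 := integral_pow_two_mul_gaussianReal hv 2
    norm_num [Nat.doubleFactorial, hvc] at h2 h4
    simp only [Pi.pow_apply, ← pow_mul]
    rw [h2, h4]
    ring
  have hvar := variance_sum_pi (ι := BV n) (X := fun _ (x : ℝ) => x ^ 2) fun _ => hmem
  have hfun : (∑ j, fun x : BV n → ℝ => x j ^ 2) = fun x => ∑ j, x j ^ 2 := by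
    ext x
    simp
  rw [hfun] at hvar
  have hmemS : MemLp (fun x : BV n → ℝ => ∑ j, x j ^ 2) 2 (gaussVec C n) :=
    memLp_finsetSum _ fun j _ =>
      hmem.comp_measurePreserving (measurePreserving_eval_gaussVec C n j)
  have hmean : ∫ x : BV n → ℝ, ∑ j, x j ^ 2 ∂(gaussVec C n) = 2 ^ n * eps C n := by
    rw [integral_finsetSum _ fun j _ =>
      integrable_pow_of_gaussian (measurePreserving_eval_gaussVec C n j) 2]
    have h2 : ∀ j : BV n, ∫ x : BV n → ℝ, x j ^ 2 ∂(gaussVec C n) = eps C n := fun j => by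
      have := integral_pow_of_gaussian (measurePreserving_eval_gaussVec C n j) hv 1
      norm_num [hvc] at this
      exact this
    simp [h2]
  refine ⟨hmemS.integrable_sq, ?_⟩
  have h := variance_eq_sub hmemS
  change variance _ (gaussVec C n) = _ at hvar
  rw [hvar, hmean] at h
  simp only [hvar1, Pi.pow_apply, Finset.sum_const, Finset.card_univ, Fintype.card_pi,
    Fintype.card_bool, Finset.prod_const, Fintype.card_fin, nsmul_eq_mul] at h
  push_cast at h
  linarith

theorem le_integral_phi_Dmeas (C : ℝ) (n : ℕ) (he : 0 < eps C n) (he1 : eps C n ≤ 1) :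
    2 * eps C n ^ 2 - 2 * eps C n ^ 2 / 2 ^ n - (105 * eps C n ^ 4 + 3 * eps C n ^ 2) / 1000
      - (2 ^ n + 500) * (4 * 2 ^ n * Real.exp (-1 / (2 * eps C n))) ≤
    ∫ z, phi n (fun i => z (Sum.inl i)) (fun i => z (Sum.inr i)) ∂(Dmeas C n) := by
  have hv : (eps C n).toNNReal ≠ 0 := by simpa using he
  have hvc : ((eps C n).toNNReal : ℝ) = eps C n := Real.coe_toNNReal _ he.le
  set μ := gaussVec C n
  set W : BV n → (BV n → ℝ) → ℝ := fun i x => (Had n).mulVec x i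
  have hWlaw : ∀ i, MeasurePreserving (W i) μ (gaussianReal 0 (eps C n).toNNReal) :=
    measurePreserving_mulVec_gaussVec C n
  have hXlaw : ∀ j, MeasurePreserving (fun x : BV n → ℝ => x j) μ
      (gaussianReal 0 (eps C n).toNNReal) := measurePreserving_eval_gaussVec C n
  let B : Set (BV n → ℝ) := (⋃ j, {x | 1 < |x j|}) ∪ ⋃ i, {x | 1 < |W i x|}
  have hBmeas : MeasurableSet B :=
    (MeasurableSet.iUnion fun j => measurableSet_lt measurable_const (by fun_prop)).union
      (MeasurableSet.iUnion fun i =>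
        measurableSet_lt measurable_const (hWlaw i).measurable.abs)
  have hBprob : μ.real B ≤ 4 * 2 ^ n * Real.exp (-1 / (2 * eps C n)) := by
    have hX : μ.real (⋃ j : BV n, {x | 1 < |x j|}) ≤
        ∑ j : BV n, 2 * Real.exp (-1 / (2 * eps C n)) :=
      (measureReal_iUnion_fintype_le _).trans (Finset.sum_le_sum fun j _ => by
        simpa only [hvc] using measureReal_one_lt_abs_le_of_gaussian (hXlaw j))
    have hY : μ.real (⋃ i : BV n, {x | 1 < |W i x|}) ≤
        ∑ j : BV n, 2 * Real.exp (-1 / (2 * eps C n)) :=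
      (measureReal_iUnion_fintype_le _).trans (Finset.sum_le_sum fun i _ => by
        simpa only [hvc] using measureReal_one_lt_abs_le_of_gaussian (hWlaw i))
    have := measureReal_union_le (μ := μ) (⋃ j : BV n, {x | 1 < |x j|}) (⋃ i, {x | 1 < |W i x|})
    simp at hX hY
    linarith
  have hWint : ∀ m, ∀ i, Integrable (fun x => W i x ^ m) μ := fun m i =>
    integrable_pow_of_gaussian (hWlaw i) m
  have hsum : ∀ m : ℕ, Integrable (fun x => ∑ i, W i x ^ m) μ := fun m =>
    integrable_finsetSum _ fun i _ => hWint m i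
  have hX2 : Integrable (fun x : BV n → ℝ => ∑ j, x j ^ 2) μ :=
    integrable_finsetSum _ fun j _ => integrable_pow_of_gaussian (hXlaw j) 2
  have hm2 : ∫ x : BV n → ℝ, ∑ j, x j ^ 2 ∂μ = 2 ^ n * eps C n := by
    rw [integral_finsetSum _ fun j _ => integrable_pow_of_gaussian (hXlaw j) 2]
    have h2 : ∀ j : BV n, ∫ x : BV n → ℝ, x j ^ 2 ∂μ = eps C n := fun j => by
      have := integral_pow_of_gaussian (hXlaw j) hv 1
      norm_num [hvc] at this
      exact this
    simp [h2]
  have hm4 : ∫ x, ∑ i, W i x ^ 4 ∂μ = 2 ^ n * (3 * eps C n ^ 2) := by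
    rw [integral_finsetSum _ fun i _ => hWint 4 i]
    have h2 : ∀ i, ∫ x, W i x ^ 4 ∂μ = 3 * eps C n ^ 2 := fun i => by
      have := integral_pow_of_gaussian (hWlaw i) hv 2
      norm_num [hvc, Nat.doubleFactorial] at this
      linarith
    simp [h2]
  have hm8 : ∫ x, ∑ i, W i x ^ 8 ∂μ = 2 ^ n * (105 * eps C n ^ 4) := by
    rw [integral_finsetSum _ fun i _ => hWint 8 i]
    have h2 : ∀ i, ∫ x, W i x ^ 8 ∂μ = 105 * eps C n ^ 4 := fun i => by
      have := integral_pow_of_gaussian (hWlaw i) hv 4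
      norm_num [hvc, Nat.doubleFactorial] at this
      linarith
    simp [h2]
  obtain ⟨hS, hmS⟩ := integral_sq_sum_sq_gaussVec C n he
  have hind : Integrable (B.indicator fun _ => (2 : ℝ) ^ n + 500) μ :=
    (integrable_const _).indicator hBmeas
  have hmind : ∫ x, B.indicator (fun _ => (2 : ℝ) ^ n + 500) x ∂μ =
      μ.real B * (2 ^ n + 500) := by
    rw [integral_indicator hBmeas, setIntegral_const, smul_eq_mul]
  rw [integral_phi_Dmeas]
  have i1 := (hsum 4).div_const (2 ^ n)
  have i2 := hX2.div_const (2 ^ n)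
  have i3 : Integrable (fun x : BV n → ℝ => ((∑ j, x j ^ 2) / 2 ^ n) ^ 2) μ := by
    simpa only [div_pow] using hS.div_const ((2 ^ n) ^ 2)
  have i4 : Integrable (fun x => (∑ i, (W i x ^ 8 + W i x ^ 4)) / 2 ^ n / 1000) μ := by
    refine Integrable.div_const (Integrable.div_const ?_ _) _
    simp only [Finset.sum_add_distrib]
    exact (hsum 8).add (hsum 4)
  have hround : Integrable (fun X => roundedPhi n X fun i => W i X ^ 2 - eps C n) μ := by
    refine Integrable.of_bound ?_ (2 ^ n)
      (Filter.Eventually.of_forall fun x => abs_roundedPhi_le n _ _)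
    exact ((measurable_roundedPhi n).comp (measurable_Gmeas'_map C n)).aestronglyMeasurable
  have hmono := integral_mono ((((i1.add i2).sub i3).sub (integrable_const (eps C n))).sub i4 |>.sub
    hind) hround fun x => le_roundedPhi n (eps C n) he.le he1 x B fun hx => by
      simp only [B, Set.mem_union, Set.mem_iUnion, Set.mem_ofPred_eq, not_or, not_exists,
        not_lt] at hx
      exact hx
  refine le_trans ?_ hmono
  simp only [Pi.sub_apply, Pi.add_apply]
  rw [integral_sub _ hind, integral_sub _ i4, integral_sub _ (integrable_const _),
    integral_sub _ i3, integral_add i1 i2, hmind]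
  rotate_left
  · exact i1.add i2
  · exact (i1.add i2).sub i3
  · exact ((i1.add i2).sub i3).sub (integrable_const _)
  · exact (((i1.add i2).sub i3).sub (integrable_const _)).sub i4
  simp only [Finset.sum_add_distrib, div_pow, integral_div]
  rw [integral_add (hsum 8) (hsum 4), hm4, hm8, hm2, hmS]
  have hle : (2 ^ n + 500) * μ.real B ≤
      (2 ^ n + 500) * (4 * 2 ^ n * Real.exp (-1 / (2 * eps C n))) :=
    mul_le_mul_of_nonneg_left hBprob (by positivity)
  have hN : (0 : ℝ) < 2 ^ n := by positivity
  simp only [integral_const, probReal_univ, one_smul]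
  have heq : 2 ^ n * (3 * eps C n ^ 2) / 2 ^ n + 2 ^ n * eps C n / 2 ^ n
      - (2 * 2 ^ n * eps C n ^ 2 + (2 ^ n * eps C n) ^ 2) / (2 ^ n) ^ 2 - eps C n
      - (2 ^ n * (105 * eps C n ^ 4) + 2 ^ n * (3 * eps C n ^ 2)) / 2 ^ n / 1000 =
      2 * eps C n ^ 2 - 2 * eps C n ^ 2 / 2 ^ n
        - (105 * eps C n ^ 4 + 3 * eps C n ^ 2) / 1000 := by
    field_simp
    ring
  rw [heq]
  linarith

/-- There exists a universal constant `C₀ ≥ 20` such that for every `C ≥ C₀`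
and all sufficiently large `N`, `E_{(X,Y) ~ D}[φ(X,Y)] ≥ ε²`. -/
theorem stmt1 :
    ∃ C₀ : ℝ, 20 ≤ C₀ ∧
      ∀ C : ℝ, C₀ ≤ C → ∃ n₀ : ℕ, ∀ n : ℕ, n₀ ≤ n →
        eps C n ^ 2 ≤
          ∫ z, phi n (fun i => z (Sum.inl i)) (fun i => z (Sum.inr i)) ∂(Dmeas C n) := by
  refine ⟨20, le_rfl, fun C hC => ⟨6, fun n hn => ?_⟩⟩
  have hN : (64 : ℝ) ≤ 2 ^ n := by
    calc (64 : ℝ) = 2 ^ 6 := by norm_num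
      _ ≤ 2 ^ n := pow_le_pow_right₀ (by norm_num) hn
  have hL : 1 ≤ Real.log (2 ^ n) := by
    rw [Real.le_log_iff_exp_le (by positivity)]
    exact (Real.exp_one_lt_d9.le.trans (by norm_num)).trans hN
  have hu : 20 ≤ C * Real.log (2 ^ n) := by nlinarith
  have hu' : eps C n = 1 / (C * Real.log (2 ^ n)) := rfl
  set u := C * Real.log (2 ^ n)
  have he : 0 < eps C n := by rw [hu']; positivity
  have he1 : eps C n ≤ 1 := by
    rw [hu', div_le_one (by positivity)]
    linarith
  refine le_trans ?_ (le_integral_phi_Dmeas C n he he1)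
  set N : ℝ := 2 ^ n
  have hexp : Real.exp (-1 / (2 * eps C n)) = Real.exp (-(u / 4)) * Real.exp (-(u / 4)) := by
    rw [← Real.exp_add, hu']
    congr 1
    field_simp
    ring
  have hexp1 : Real.exp (-(u / 4)) ≤ 32 * eps C n ^ 2 := by
    have h := Real.pow_div_factorial_le_exp (u / 4) (by positivity) 2
    have h' : u ^ 2 / 32 ≤ Real.exp (u / 4) := by
      norm_num [Nat.factorial] at h
      linarith
    rw [Real.exp_neg]
    refine (inv_anti₀ (by positivity) h').trans (le_of_eq ?_)
    rw [hu']
    field_simp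
  have hexp2 : Real.exp (-(u / 4)) ≤ 1 / N ^ 5 := by
    have : N ^ 5 ≤ Real.exp (u / 4) := by
      rw [← Real.exp_log (show 0 < N by positivity), ← Real.exp_nat_mul]
      refine Real.exp_le_exp.mpr ?_
      push_cast
      nlinarith
    rw [Real.exp_neg, one_div]
    exact inv_anti₀ (by positivity) this
  have hprod : (N + 500) * (4 * N * Real.exp (-1 / (2 * eps C n))) ≤ eps C n ^ 2 / 4 := by
    rw [hexp]
    calc (N + 500) * (4 * N * (Real.exp (-(u / 4)) * Real.exp (-(u / 4))))
        ≤ (N + 500) * (4 * N * (32 * eps C n ^ 2 * (1 / N ^ 5))) := by gcongr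
      _ = eps C n ^ 2 * ((N + 500) * 128 / N ^ 4) := by field_simp; ring
      _ ≤ eps C n ^ 2 * (1 / 4) := by
        refine mul_le_mul_of_nonneg_left ?_ (sq_nonneg _)
        rw [div_le_div_iff₀ (by positivity) (by norm_num)]
        have h3 : (64 : ℝ) ^ 3 ≤ N ^ 3 := by gcongr
        have h4 := mul_le_mul_of_nonneg_right h3 (show 0 ≤ N by positivity)
        nlinarith
      _ = eps C n ^ 2 / 4 := by ring
  have h1 : 2 * eps C n ^ 2 / N ≤ eps C n ^ 2 / 32 := by
    rw [div_le_div_iff₀ (by positivity) (by norm_num)]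
    nlinarith [sq_nonneg (eps C n)]
  have h2 : eps C n ^ 4 ≤ eps C n ^ 2 := pow_le_pow_of_le_one he.le he1 (by norm_num)
  linarith [sq_nonneg (eps C n)]
end
end

section
/- For any constant c ≥ 2 there exists a choice of the constant C in the definition of ε = 1/(C·ln N) such that E_{(x,y) ~ G'}[ ∏_{i=1}^{N} max(1, |x_i|) · ∏_{i=1}^{N} max(1, |y_i|) · 1_{(x,y) ≠ trnc(x,y)} ] ≤ 4·N^{−c}. -/
open MeasureTheory ProbabilityTheory Finset

noncomputable section

lemma neg_one_pow_bip {n : ℕ} (x z : BV n) :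
    (-1 : ℝ) ^ bip x z = ∏ i, if x i && z i then (-1 : ℝ) else 1 := by
  rw [bip, Finset.prod_ite]
  simp

lemma Had_mul_transpose (n : ℕ) : Had n * (Had n).transpose = 1 := by
  ext x y
  have hs : Real.sqrt (2 ^ n) * Real.sqrt (2 ^ n) = 2 ^ n := Real.mul_self_sqrt (by positivity)
  have key : ∑ z : BV n, (-1 : ℝ) ^ bip x z * (-1 : ℝ) ^ bip y z = if x = y then 2 ^ n else 0 := by
    simp_rw [neg_one_pow_bip, ← Finset.prod_mul_distrib]
    have h := Finset.prod_univ_sum (fun _ : Fin n => (Finset.univ : Finset Bool))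
      (fun i b => (if x i && b then (-1 : ℝ) else 1) * (if y i && b then (-1 : ℝ) else 1))
    rw [Fintype.piFinset_univ] at h
    rw [← h]
    split_ifs with hxy
    · subst hxy
      rw [Finset.prod_eq_pow_card (b := (2 : ℝ))]
      · simp
      · intro i _
        cases x i <;> norm_num
    · obtain ⟨i, hi⟩ := Function.ne_iff.mp hxy
      refine Finset.prod_eq_zero (Finset.mem_univ i) ?_
      cases hx : x i <;> cases hy : y i <;> simp_all
  rw [Matrix.mul_apply, Matrix.one_apply]
  simp only [Had, Matrix.transpose_apply, Matrix.of_apply, div_mul_div_comm, hs]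
  rw [← Finset.sum_div, key]
  split_ifs <;> simp

lemma map_mulVec_pi_gaussianReal {ι : Type*} [Fintype ι] [DecidableEq ι] (v : NNReal)
    (A : Matrix ι ι ℝ) (hA : A * A.transpose = 1) :
    (Measure.pi fun _ : ι => gaussianReal 0 v).map A.mulVec =
      Measure.pi fun _ : ι => gaussianReal 0 v := by
  have hAm : Measurable A.mulVec := by
    have : Continuous A.mulVec := by fun_prop
    exact this.measurable
  have hchar (t : EuclideanSpace ℝ ι) :
      charFun ((Measure.pi fun _ : ι => gaussianReal 0 v).map (WithLp.toLp 2)) t =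
        Complex.exp (-(v * ((t.ofLp ⬝ᵥ t.ofLp : ℝ) : ℂ)) / 2) := by
    rw [charFun_pi]
    simp_rw [charFun_gaussianReal, ← Complex.exp_sum]
    congr 1
    simp [dotProduct, Finset.sum_div, Finset.mul_sum, neg_div, pow_two]
  have hmE : Measurable (WithLp.toLp 2 : (ι → ℝ) → EuclideanSpace ℝ ι) := by fun_prop
  have key : ((Measure.pi fun _ : ι => gaussianReal 0 v).map A.mulVec).map
        (WithLp.toLp 2 : (ι → ℝ) → EuclideanSpace ℝ ι) =
      (Measure.pi fun _ : ι => gaussianReal 0 v).map (WithLp.toLp 2) := by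
    have : IsProbabilityMeasure ((Measure.pi fun _ : ι => gaussianReal 0 v).map A.mulVec) :=
      Measure.isProbabilityMeasure_map hAm.aemeasurable
    have : IsProbabilityMeasure (((Measure.pi fun _ : ι => gaussianReal 0 v).map A.mulVec).map
        (WithLp.toLp 2 : (ι → ℝ) → EuclideanSpace ℝ ι)) :=
      Measure.isProbabilityMeasure_map hmE.aemeasurable
    have : IsProbabilityMeasure ((Measure.pi fun _ : ι => gaussianReal 0 v).map
        (WithLp.toLp 2 : (ι → ℝ) → EuclideanSpace ℝ ι)) :=
      Measure.isProbabilityMeasure_map hmE.aemeasurable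
    apply Measure.ext_of_charFun
    ext t
    have h1 : charFun (((Measure.pi fun _ : ι => gaussianReal 0 v).map A.mulVec).map
        (WithLp.toLp 2 : (ι → ℝ) → EuclideanSpace ℝ ι)) t =
        charFun ((Measure.pi fun _ : ι => gaussianReal 0 v).map (WithLp.toLp 2))
          (WithLp.toLp 2 (A.transpose.mulVec t.ofLp)) := by
      rw [Measure.map_map hmE hAm, charFun_apply, charFun_apply,
        integral_map (hmE.comp hAm).aemeasurable (by fun_prop),
        integral_map hmE.aemeasurable (by fun_prop)]
      congr 1
      ext x
      congr 3
      simp only [Function.comp, EuclideanSpace.inner_eq_star_dotProduct, star_trivial]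
      rw [Matrix.dotProduct_mulVec, Matrix.mulVec_transpose]
    rw [h1, hchar, hchar]
    congr 4
    simp only
    rw [Matrix.dotProduct_mulVec, Matrix.vecMul_transpose, Matrix.mulVec_mulVec, hA,
      Matrix.one_mulVec]
  have := congrArg (Measure.map (WithLp.ofLp : EuclideanSpace ℝ ι → (ι → ℝ))) key
  rwa [Measure.map_map (by fun_prop) hmE, Measure.map_map (by fun_prop) hmE,
    show (WithLp.ofLp : EuclideanSpace ℝ ι → (ι → ℝ)) ∘ WithLp.toLp 2 = id from rfl,
    Measure.map_id, Measure.map_id] at this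

/-- A smooth majorant of `x ^ 4 * 1_{|x| > 1}` with explicit Gaussian expectation. -/
def expMajorant (L x : ℝ) : ℝ :=
  24 * Real.exp (1 - L) * (Real.exp (L * x) + Real.exp (-L * x))

lemma expMajorant_nonneg (L x : ℝ) : 0 ≤ expMajorant L x := by
  unfold expMajorant
  positivity

lemma pow_four_le_expMajorant {L x : ℝ} (hL : 1 ≤ L) (hx : 1 ≤ |x|) :
    |x| ^ 4 ≤ expMajorant L x := by
  have h1 : |x| ^ 4 ≤ 24 * Real.exp |x| := by
    have := Real.pow_div_factorial_le_exp |x| (abs_nonneg x) 4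
    norm_num [Nat.factorial] at this ⊢
    linarith
  have h2 : Real.exp |x| ≤ Real.exp (1 - L) * Real.exp (L * |x|) := by
    rw [← Real.exp_add]
    apply Real.exp_le_exp.mpr
    nlinarith
  have h3 : Real.exp (L * |x|) ≤ Real.exp (L * x) + Real.exp (-L * x) := by
    rcases abs_choice x with h | h <;> rw [h]
    · linarith [Real.exp_pos (-L * x)]
    · rw [show L * -x = -L * x by ring]
      linarith [Real.exp_pos (L * x)]
  calc |x| ^ 4 ≤ 24 * Real.exp |x| := h1
    _ ≤ 24 * (Real.exp (1 - L) * Real.exp (L * |x|)) := by gcongr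
    _ ≤ 24 * (Real.exp (1 - L) * (Real.exp (L * x) + Real.exp (-L * x))) := by gcongr
    _ = expMajorant L x := by rw [expMajorant]; ring

lemma integrable_expMajorant (L : ℝ) (v : NNReal) :
    Integrable (expMajorant L) (gaussianReal 0 v) :=
  ((integrable_exp_mul_gaussianReal L).add (integrable_exp_mul_gaussianReal (-L))).const_mul _

lemma integral_expMajorant {L : ℝ} {v : NNReal} (hv : v * L = 1) :
    ∫ x, expMajorant L x ∂(gaussianReal 0 v) = 48 * Real.exp (1 - L / 2) := by
  have hm (t : ℝ) : ∫ x, Real.exp (t * x) ∂(gaussianReal 0 v) = Real.exp (v * t ^ 2 / 2) := by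
    have := mgf_gaussianReal (p := gaussianReal 0 v) (X := id) (μ := 0) (v := v) (by simp) t
    simpa [mgf] using this
  unfold expMajorant
  rw [integral_const_mul, integral_add (integrable_exp_mul_gaussianReal L)
    (integrable_exp_mul_gaussianReal (-L)), hm, hm]
  have h1 : (v : ℝ) * L ^ 2 / 2 = L / 2 := by rw [pow_two, ← mul_assoc, hv]; ring
  have h2 : (v : ℝ) * (-L) ^ 2 / 2 = L / 2 := by rw [neg_sq, h1]
  rw [h1, h2, show 1 - L / 2 = (1 - L) + L / 2 by ring, Real.exp_add]
  ring

lemma prod_max_pow_four_le {ι : Type*} [Fintype ι] {L : ℝ} (hL : 1 ≤ L) (u : ι → ℝ)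
    (hu : ∃ j, 1 < |u j|) :
    (∏ i, max 1 |u i|) ^ 4 ≤ ∏ i, (1 + expMajorant L (u i)) - 1 := by
  classical
  obtain ⟨j, hj⟩ := hu
  have hle (i : ι) : max 1 |u i| ^ 4 ≤ 1 + expMajorant L (u i) := by
    rcases le_total |u i| 1 with h | h
    · rw [max_eq_left h]
      linarith [expMajorant_nonneg L (u i)]
    · rw [max_eq_right h]
      linarith [pow_four_le_expMajorant hL h]
  rw [← Finset.prod_pow, ← Finset.mul_prod_erase _ _ (Finset.mem_univ j),
    ← Finset.mul_prod_erase (a := j) _ (fun i => 1 + expMajorant L (u i)) (Finset.mem_univ j)]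
  have h1 : (1 : ℝ) ≤ ∏ i ∈ Finset.univ.erase j, max 1 |u i| ^ 4 :=
    Finset.one_le_prod fun i _ => one_le_pow₀ (le_max_left _ _)
  have h2 : ∏ i ∈ Finset.univ.erase j, max 1 |u i| ^ 4 ≤
      ∏ i ∈ Finset.univ.erase j, (1 + expMajorant L (u i)) :=
    Finset.prod_le_prod (fun i _ => by positivity) fun i _ => hle i
  have h3 := pow_four_le_expMajorant hL hj.le
  rw [max_eq_right hj.le]
  have h4 : 0 ≤ |u j| ^ 4 := by positivity
  nlinarith [mul_le_mul (by linarith : 1 + |u j| ^ 4 ≤ 1 + expMajorant L (u j)) h2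
    (by linarith) (by linarith)]

lemma one_le_prod_expMajorant {ι : Type*} [Fintype ι] (L : ℝ) (u : ι → ℝ) :
    1 ≤ ∏ i, (1 + expMajorant L (u i)) :=
  Finset.one_le_prod fun i _ => by linarith [expMajorant_nonneg L (u i)]

lemma one_lt_abs_of_ne_trnc {a : ℝ} (h : a ≠ trnc a) : 1 < |a| := by
  by_contra! hle
  obtain ⟨h1, h2⟩ := abs_le.mp hle
  exact h (by rw [trnc, max_eq_right h1, min_eq_right h2])

lemma abs_sq_sub_le {y e : ℝ} (he0 : 0 ≤ e) (he1 : e ≤ 1) :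
    |y ^ 2 - e| ≤ max 1 |y| ^ 2 := by
  have h1 : 1 ≤ max 1 |y| := le_max_left _ _
  have h2 : |y| ≤ max 1 |y| := le_max_right _ _
  have h3 : y ^ 2 ≤ max 1 |y| ^ 2 := by
    rw [← sq_abs y]
    gcongr
  rw [abs_le]
  constructor <;> nlinarith [sq_nonneg y]

lemma truncation_error_le {ι : Type*} [Fintype ι] {L e : ℝ} (hL : 1 ≤ L) (he0 : 0 ≤ e)
    (he1 : e ≤ 1) (x y : ι → ℝ) :
    (∏ i, max 1 |x i|) * (∏ i, max 1 |y i ^ 2 - e|) *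
        (if ∃ i, Sum.elim x (fun i => y i ^ 2 - e) i ≠ trnc (Sum.elim x (fun i => y i ^ 2 - e) i)
          then (1 : ℝ) else 0) ≤
      (∏ i, (1 + expMajorant L (x i)) - 1) + (∏ i, (1 + expMajorant L (y i)) - 1) := by
  have hPx := one_le_prod_expMajorant L x
  have hPy := one_le_prod_expMajorant L y
  split_ifs with h
  swap
  · linarith
  have hP1 : 1 ≤ ∏ i, max 1 |x i| := Finset.one_le_prod fun i _ => le_max_left _ _
  have hQ1 : 1 ≤ ∏ i, max 1 |y i| := Finset.one_le_prod fun i _ => le_max_left _ _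
  have hQ : ∏ i, max 1 |y i ^ 2 - e| ≤ (∏ i, max 1 |y i|) ^ 2 := by
    rw [← Finset.prod_pow]
    refine Finset.prod_le_prod (fun i _ => by positivity) fun i _ => max_le ?_ ?_
    · exact one_le_pow₀ (le_max_left _ _)
    · exact abs_sq_sub_le he0 he1
  have hex : (∃ j, 1 < |x j|) ∨ ∃ j, 1 < |y j| := by
    obtain ⟨i | i, hi⟩ := h
    · exact Or.inl ⟨i, one_lt_abs_of_ne_trnc hi⟩
    · refine Or.inr ⟨i, ?_⟩
      by_contra! hle
      have := one_lt_abs_of_ne_trnc hi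
      have h2 := abs_sq_sub_le (y := y i) he0 he1
      rw [max_eq_left hle] at h2
      simp only [Sum.elim_inr] at this
      linarith
  have hall (u : ι → ℝ) (hu : ∏ i, max 1 |u i| ≤ 1) : ¬∃ j, 1 < |u j| := fun ⟨j, hj⟩ => by
    have h1 : max 1 |u j| ≤ ∏ i, max 1 |u i| := by
      classical
      rw [← Finset.mul_prod_erase _ _ (Finset.mem_univ j)]
      exact le_mul_of_one_le_right (by positivity)
        (Finset.one_le_prod fun i _ => le_max_left _ _)
    linarith [le_max_right 1 |u j|]
  have hone (u : ι → ℝ) (hu : ¬∃ j, 1 < |u j|) : ∏ i, max 1 |u i| = 1 := by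
    push Not at hu
    exact Finset.prod_eq_one fun i _ => max_eq_left (hu i)
  set P := ∏ i, max 1 |x i|
  set Q := ∏ i, max 1 |y i|
  have hprod : P * (∏ i, max 1 |y i ^ 2 - e|) * 1 ≤ P * Q ^ 2 := by
    rw [mul_one]
    gcongr
  refine hprod.trans ?_
  rcases le_total P Q with hPQ | hPQ
  · have hy : ∃ j, 1 < |y j| := by
      by_contra hy
      exact hex.elim (hall x (hPQ.trans_eq (hone y hy))) hy
    have := prod_max_pow_four_le hL y hy
    have hle : P * Q ^ 2 ≤ Q ^ 4 := by
      calc P * Q ^ 2 ≤ Q * Q ^ 2 := by gcongr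
        _ = Q ^ 3 := by ring
        _ ≤ Q ^ 4 := pow_le_pow_right₀ hQ1 (by norm_num)
    linarith
  · have hx : ∃ j, 1 < |x j| := by
      by_contra hx
      exact hex.elim hx (hall y (hPQ.trans_eq (hone x hx)))
    have := prod_max_pow_four_le hL x hx
    have hle : P * Q ^ 2 ≤ P ^ 4 := by
      calc P * Q ^ 2 ≤ P * P ^ 2 := by gcongr
        _ = P ^ 3 := by ring
        _ ≤ P ^ 4 := pow_le_pow_right₀ hP1 (by norm_num)
    linarith

lemma eps_facts {C : ℝ} (hC : 20 ≤ C) {n : ℕ} (hn : 1 ≤ n) :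
    1 ≤ C * Real.log (2 ^ n) ∧ 0 ≤ eps C n ∧ eps C n ≤ 1 ∧
      eps C n * (C * Real.log (2 ^ n)) = 1 := by
  have h1 : Real.log 2 ≤ Real.log (2 ^ n) :=
    Real.log_le_log (by norm_num) (le_self_pow₀ (by norm_num) (by omega))
  have h2 := Real.log_two_gt_d9
  have h3 : 1 ≤ C * Real.log (2 ^ n) := by nlinarith
  refine ⟨h3, by unfold eps; positivity, ?_, ?_⟩
  · unfold eps
    exact (div_le_one (by linarith)).mpr h3
  · unfold eps
    field_simp

lemma tail_bound {c : ℝ} (hc : 2 ≤ c) {n : ℕ} (hn : 1 ≤ n) :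
    (1 + 48 * Real.exp (1 - (2 * c + 18) * Real.log (2 ^ n) / 2)) ^ (2 ^ n) - 1 ≤
      2 * (2 ^ n : ℝ) ^ (-c) := by
  set N : ℝ := 2 ^ n with hN
  have hN2 : 2 ≤ N := le_self_pow₀ (by norm_num) (by omega)
  have hN0 : 0 < N := by linarith
  set δ := 48 * Real.exp (1 - (2 * c + 18) * Real.log N / 2) with hδ
  have hδ0 : 0 ≤ δ := by positivity
  have hexp : δ = 48 * Real.exp 1 * (N ^ (-c) * (N ^ 9)⁻¹) := by
    rw [← Real.rpow_natCast N 9, ← Real.rpow_neg hN0.le, ← Real.rpow_add hN0,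
      Real.rpow_def_of_pos hN0, mul_assoc, ← Real.exp_add, hδ]
    push_cast
    ring_nf
  have hr0 : 0 < N ^ (-c) := Real.rpow_pos_of_pos hN0 _
  have hr1 : N ^ (-c) ≤ 1 := Real.rpow_le_one_of_one_le_of_nonpos (by linarith) (by linarith)
  have hN8 : 48 * Real.exp 1 ≤ N ^ 8 := by
    have : (2 : ℝ) ^ 8 ≤ N ^ 8 := by gcongr
    linarith [Real.exp_one_lt_d9]
  have hNδ : N * δ ≤ N ^ (-c) := by
    rw [hexp]
    have : N * (48 * Real.exp 1 * (N ^ (-c) * (N ^ 9)⁻¹)) =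
        N ^ (-c) * (48 * Real.exp 1 / N ^ 8) := by
      field_simp
    rw [this]
    exact mul_le_of_le_one_right hr0.le ((div_le_one (by positivity)).mpr hN8)
  have h1 : (1 + δ) ^ (2 ^ n) ≤ Real.exp (N * δ) := by
    have : (1 + δ) ^ (2 ^ n) ≤ Real.exp δ ^ (2 ^ n) := by
      gcongr
      linarith [Real.add_one_le_exp δ]
    rwa [← Real.exp_nat_mul, Nat.cast_pow, Nat.cast_ofNat] at this
  have h2 : 0 ≤ N * δ := by positivity
  have h3 := Real.abs_exp_sub_one_le (x := N * δ) (by rw [abs_of_nonneg h2]; linarith)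
  rw [abs_of_nonneg h2] at h3
  linarith [le_abs_self (Real.exp (N * δ) - 1)]

/-- For any constant `c ≥ 2` there exists a choice of the constant `C` in
the definition of `ε = 1/(C ln N)` such that
`E_{(x,y) ~ G'}[∏ max(1,|x_i|) ∏ max(1,|y_i|) 1_{(x,y) ≠ trnc(x,y)}] ≤ 4 N⁻ᶜ`. -/
theorem stmt7 :
    ∀ c : ℝ, 2 ≤ c → ∃ C : ℝ, 20 ≤ C ∧
      ∀ n : ℕ, 1 ≤ n →
        ∫ z, (∏ i, max 1 |z (Sum.inl i)|) * (∏ i, max 1 |z (Sum.inr i)|) *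
            (if ∃ i, z i ≠ trnc (z i) then (1 : ℝ) else 0) ∂(Gmeas' C n)
          ≤ 4 * (2 ^ n : ℝ) ^ (-c) := by
  intro c hc
  refine ⟨2 * c + 18, by linarith, fun n hn => ?_⟩
  set C := 2 * c + 18 with hCdef
  obtain ⟨hL, he0, he1, heL⟩ := eps_facts (C := C) (by linarith) hn
  set L := C * Real.log (2 ^ n) with hLdef
  set v := (eps C n).toNNReal with hv
  have hvL : (v : ℝ) * L = 1 := by rw [hv, Real.coe_toNNReal _ he0, heL]
  let g : (BV n → ℝ) → ℝ := fun u => ∏ i, (1 + expMajorant L (u i)) - 1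
  have hmajor : Integrable (fun x => 1 + expMajorant L x) (gaussianReal 0 v) :=
    (integrable_const 1).add (integrable_expMajorant L v)
  have hprod : Integrable (fun u : BV n → ℝ => ∏ i, (1 + expMajorant L (u i))) (gaussVec C n) :=
    Integrable.fintype_prod (f := fun _ x => 1 + expMajorant L x) fun _ => hmajor
  have : IsProbabilityMeasure (gaussVec C n) := by unfold gaussVec; infer_instance
  have hg : Integrable g (gaussVec C n) := hprod.sub (integrable_const 1)
  have hgint : ∫ u, g u ∂(gaussVec C n) ≤ 2 * (2 ^ n : ℝ) ^ (-c) := by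
    rw [integral_sub hprod (integrable_const 1), gaussVec,
      integral_fintype_prod_eq_pow (fun x => 1 + expMajorant L x),
      integral_add (integrable_const 1) (integrable_expMajorant L v), integral_expMajorant hvL]
    simpa [hLdef, hCdef] using tail_bound hc hn
  have hAm : Measurable (Had n).mulVec := by
    have : Continuous (Had n).mulVec := by fun_prop
    exact this.measurable
  have hmap : (gaussVec C n).map (Had n).mulVec = gaussVec C n :=
    map_mulVec_pi_gaussianReal _ _ (Had_mul_transpose n)
  have hgH : Integrable (fun X => g ((Had n).mulVec X)) (gaussVec C n) := by
    refine Integrable.comp_measurable (g := g) ?_ hAm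
    rwa [hmap]
  have hgHint : ∫ X, g ((Had n).mulVec X) ∂(gaussVec C n) = ∫ u, g u ∂(gaussVec C n) := by
    rw [← integral_map hAm.aemeasurable (by rw [hmap]; exact hg.aestronglyMeasurable), hmap]
  have hT : Measurable fun X : BV n → ℝ =>
      (Sum.elim X fun i => ((Had n).mulVec X i) ^ 2 - eps C n : BV n ⊕ BV n → ℝ) := by
    refine measurable_pi_iff.mpr ?_
    rintro (i | i)
    · exact measurable_pi_apply i
    · exact (((measurable_pi_apply i).comp hAm).pow_const 2).sub_const _
  have htr : Measurable trnc := by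
    unfold trnc
    fun_prop
  have hF : Measurable fun z : BV n ⊕ BV n → ℝ =>
      (∏ i, max 1 |z (Sum.inl i)|) * (∏ i, max 1 |z (Sum.inr i)|) *
        (if ∃ i, z i ≠ trnc (z i) then (1 : ℝ) else 0) := by
    refine Measurable.mul (by fun_prop) (Measurable.ite ?_ measurable_const measurable_const)
    simp only [Set.ofPred_exists]
    refine MeasurableSet.iUnion fun i => (measurableSet_eq_fun ?_ ?_).compl
    · exact measurable_pi_apply i
    · exact htr.comp (measurable_pi_apply i)
  rw [Gmeas', integral_map hT.aemeasurable hF.aestronglyMeasurable]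
  calc _ ≤ ∫ X, (g X + g ((Had n).mulVec X)) ∂(gaussVec C n) := by
        refine integral_mono_of_nonneg (ae_of_all _ fun X => ?_) (hg.add hgH)
          (ae_of_all _ fun X => truncation_error_le hL he0 he1 X ((Had n).mulVec X))
        refine mul_nonneg (mul_nonneg ?_ ?_) (by split_ifs <;> norm_num) <;>
          exact Finset.prod_nonneg fun i _ => by positivity
    _ = ∫ u, g u ∂(gaussVec C n) + ∫ u, g u ∂(gaussVec C n) := by
        rw [integral_add hg hgH, hgHint]
    _ ≤ 4 * (2 ^ n : ℝ) ^ (-c) := by linarith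
end
end
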